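/- arXiv:2605.01968 — 4 statements merged into one kernel-verified Lean document; each statement's English description precedes it below -/
import Mathlib

section
/- Let B be a finite index set and for each b ∈ B let W_b ∈ ℝ^{r_b×c_b}. Then there exists a family {Q_b}_{b∈B} with each Q_b ∈ ℝ^{r_b×c_b} semi-orthogonal such that Σ_{b∈B} ‖W_b − Q_b‖_F² ≤ 4·Σ_{b∈B} R(W_b). In particular, for a single matrix W ∈ ℝ^{r×c} there exists a semi-orthogonal Q ∈ ℝ^{r×c} with ‖W − Q‖_F² ≤ 4·R(W). -/
open scoped Matrix

/-- The Frobenius norm of a real matrix. -/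
noncomputable def Matrix.frobNorm {m n : Type*} [Fintype m] [Fintype n]
    (A : Matrix m n ℝ) : ℝ :=
  Real.sqrt (∑ i, ∑ j, (A i j) ^ 2)

/-- A real `r × c` matrix is semi-orthogonal if `QQᵀ = I_r` when `r < c`,
and `QᵀQ = I_c` when `r ≥ c`. -/
def Matrix.IsSemiOrthogonal {r c : ℕ} (Q : Matrix (Fin r) (Fin c) ℝ) : Prop :=
  if r < c then Q * Qᵀ = 1 else Qᵀ * Q = 1

/-- The orthogonality defect `R(W) = ¼‖WWᵀ − I_r‖_F²` if `r < c`,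
and `¼‖WᵀW − I_c‖_F²` if `r ≥ c`. -/
noncomputable def Matrix.orthDefect {r c : ℕ} (W : Matrix (Fin r) (Fin c) ℝ) : ℝ :=
  if r < c then (1 / 4) * (W * Wᵀ - 1).frobNorm ^ 2
  else (1 / 4) * (Wᵀ * W - 1).frobNorm ^ 2

namespace Matrix

theorem frobNorm_sq {m n : Type*} [Fintype m] [Fintype n] (A : Matrix m n ℝ) :
    A.frobNorm ^ 2 = (Aᵀ * A).trace := by
  rw [frobNorm, Real.sq_sqrt (by positivity), Finset.sum_comm]
  simp [trace, mul_apply, sq]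

theorem frobNorm_transpose {m n : Type*} [Fintype m] [Fintype n] (A : Matrix m n ℝ) :
    Aᵀ.frobNorm = A.frobNorm := by
  rw [frobNorm, frobNorm, Finset.sum_comm]
  rfl

/-- The Frobenius norm is invariant under multiplication by matrices with orthonormal columns. -/
theorem frobNorm_sq_mul_mul_transpose {m n k l : Type*} [Fintype m] [Fintype n] [Fintype k]
    [Fintype l] [DecidableEq n] [DecidableEq l] {U : Matrix m n ℝ} {V : Matrix k l ℝ}
    (hU : Uᵀ * U = 1) (hV : Vᵀ * V = 1) (A : Matrix n l ℝ) :
    (U * A * Vᵀ).frobNorm ^ 2 = A.frobNorm ^ 2 := by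
  rw [frobNorm_sq, frobNorm_sq]
  calc ((U * A * Vᵀ)ᵀ * (U * A * Vᵀ)).trace
      = (V * (Aᵀ * (Uᵀ * U) * A * Vᵀ)).trace := by
        simp only [transpose_mul, transpose_transpose, Matrix.mul_assoc]
    _ = (Aᵀ * A).trace := by
        rw [trace_mul_comm, hU, Matrix.mul_one, Matrix.mul_assoc, hV, Matrix.mul_one]

theorem frobNorm_sq_diagonal {n : Type*} [Fintype n] [DecidableEq n] (d : n → ℝ) :
    (diagonal d).frobNorm ^ 2 = ∑ i, d i ^ 2 := by
  rw [frobNorm_sq]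
  simp [trace_diagonal, sq]

/-- A matrix with orthogonal columns factors as a matrix with orthonormal columns times a
nonnegative diagonal matrix. -/
theorem exists_mul_diagonal_of_transpose_mul_self {r c : ℕ} (h : c ≤ r)
    (X : Matrix (Fin r) (Fin c) ℝ) (e : Fin c → ℝ) (hX : Xᵀ * X = diagonal e) :
    ∃ (U : Matrix (Fin r) (Fin c) ℝ) (d : Fin c → ℝ),
      Uᵀ * U = 1 ∧ (∀ i, 0 ≤ d i) ∧ X = U * diagonal d := by
  have hXe (i j : Fin c) : ∑ k, X k i * X k j = if i = j then e i else 0 := by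
    have := congrFun (congrFun hX i) j
    simpa [mul_apply, diagonal_apply] using this
  have he (i : Fin c) : 0 ≤ e i := by
    have := hXe i i
    rw [if_pos rfl] at this
    rw [← this]
    exact Finset.sum_nonneg fun k _ => mul_self_nonneg _
  let x : Fin r → EuclideanSpace ℝ (Fin r) := fun j =>
    if hj : (j : ℕ) < c then WithLp.toLp 2 fun k => (√(e ⟨j, hj⟩))⁻¹ * X k ⟨j, hj⟩ else 0
  let s : Set (Fin r) := {j | ∃ i : Fin c, Fin.castLE h i = j ∧ e i ≠ 0}
  have hx (i : Fin c) : x (Fin.castLE h i) = WithLp.toLp 2 fun k => (√(e i))⁻¹ * X k i := by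
    simp [x]
  have hs : Orthonormal ℝ (s.domRestrict x) := by
    rw [orthonormal_iff_ite]
    rintro ⟨_, i, rfl, hi⟩ ⟨_, j, rfl, hj⟩
    have hsum : inner ℝ (x (Fin.castLE h i)) (x (Fin.castLE h j)) =
        (√(e i))⁻¹ * (√(e j))⁻¹ * ∑ k, X k i * X k j := by
      rw [hx, hx, Finset.mul_sum]
      simp only [PiLp.inner_apply, RCLike.inner_apply, conj_trivial]
      exact Finset.sum_congr rfl fun k _ => by ring
    simp only [Subtype.mk.injEq, Fin.castLE_inj]
    refine hsum.trans ?_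
    rw [hXe]
    split_ifs with hij
    · subst hij
      have := Real.sq_sqrt (he i)
      have hne : √(e i) ≠ 0 := (Real.sqrt_pos.2 (lt_of_le_of_ne (he i) hi.symm)).ne'
      field_simp
      exact this.symm
    · simp
  obtain ⟨b, hb⟩ := hs.exists_orthonormalBasis_extension_of_card_eq (by simp)
  refine ⟨of fun k i => b (Fin.castLE h i) k, fun i => √(e i), ?_, fun i => Real.sqrt_nonneg _, ?_⟩
  · ext i j
    have := orthonormal_iff_ite.1 b.orthonormal (Fin.castLE h j) (Fin.castLE h i)
    simpa [PiLp.inner_apply, mul_apply, one_apply, eq_comm] using this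
  · ext k i
    rw [mul_diagonal, of_apply]
    by_cases hi : e i = 0
    · have h0 := hXe i i
      rw [if_pos rfl, hi, Finset.sum_eq_zero_iff_of_nonneg fun k _ => mul_self_nonneg _] at h0
      simpa [hi] using h0 k (Finset.mem_univ k)
    · have hne : √(e i) ≠ 0 := (Real.sqrt_pos.2 (lt_of_le_of_ne (he i) (Ne.symm hi))).ne'
      rw [hb _ ⟨i, rfl, hi⟩, hx]
      simp only
      field_simp

/-- Thin singular value decomposition of a matrix with at least as many rows as columns. -/
theorem exists_thin_svd {r c : ℕ} (h : c ≤ r) (W : Matrix (Fin r) (Fin c) ℝ) :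
    ∃ (U : Matrix (Fin r) (Fin c) ℝ) (V : Matrix (Fin c) (Fin c) ℝ) (d : Fin c → ℝ),
      Uᵀ * U = 1 ∧ Vᵀ * V = 1 ∧ (∀ i, 0 ≤ d i) ∧ W = U * diagonal d * Vᵀ := by
  have hA : (Wᵀ * W).IsHermitian := by
    simpa [conjTranspose_eq_transpose_of_trivial] using isHermitian_conjTranspose_mul_self W
  let V : Matrix (Fin c) (Fin c) ℝ := hA.eigenvectorUnitary
  have hV : Vᵀ * V = 1 := by
    simpa [V, star_eq_conjTranspose, conjTranspose_eq_transpose_of_trivial] using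
      Unitary.coe_star_mul_self hA.eigenvectorUnitary
  have hspec : Wᵀ * W = V * diagonal hA.eigenvalues * Vᵀ := by
    have := hA.spectral_theorem
    rw [Unitary.conjStarAlgAut_apply] at this
    simpa [V, star_eq_conjTranspose, conjTranspose_eq_transpose_of_trivial, Function.comp_def]
      using this
  obtain ⟨U, d, hU, hd, hWV⟩ := exists_mul_diagonal_of_transpose_mul_self h (W * V)
    hA.eigenvalues (by
      calc (W * V)ᵀ * (W * V) = Vᵀ * (Wᵀ * W) * V := by
            simp only [transpose_mul, Matrix.mul_assoc]
        _ = (Vᵀ * V) * diagonal hA.eigenvalues * (Vᵀ * V) := by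
            simp only [congrArg (Vᵀ * · * V) hspec, Matrix.mul_assoc]
        _ = _ := by rw [hV, Matrix.one_mul, Matrix.mul_one])
  refine ⟨U, V, d, hU, hV, hd, ?_⟩
  rw [← hWV, Matrix.mul_assoc, mul_eq_one_comm.1 hV, Matrix.mul_one]

theorem exists_transpose_mul_self_eq_one_frobNorm_sub_le {r c : ℕ} (h : c ≤ r)
    (W : Matrix (Fin r) (Fin c) ℝ) :
    ∃ Q : Matrix (Fin r) (Fin c) ℝ, Qᵀ * Q = 1 ∧
      (W - Q).frobNorm ^ 2 ≤ (Wᵀ * W - 1).frobNorm ^ 2 := by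
  obtain ⟨U, V, d, hU, hV, hd, rfl⟩ := exists_thin_svd h W
  have hV' : V * Vᵀ = 1 := mul_eq_one_comm.1 hV
  have hsub : U * diagonal d * Vᵀ - U * Vᵀ = U * diagonal (fun i => d i - 1) * Vᵀ := by
    rw [← diagonal_sub, diagonal_one, Matrix.mul_sub, Matrix.sub_mul, Matrix.mul_one]
  have hgram : (U * diagonal d * Vᵀ)ᵀ * (U * diagonal d * Vᵀ) - 1 =
      V * diagonal (fun i => d i * d i - 1) * Vᵀ := by
    rw [← diagonal_sub, diagonal_one, Matrix.mul_sub, Matrix.sub_mul, Matrix.mul_one, hV',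
      ← diagonal_mul_diagonal]
    calc _ = V * diagonal d * (Uᵀ * U) * diagonal d * Vᵀ - 1 := by
          simp only [transpose_mul, transpose_transpose, diagonal_transpose, Matrix.mul_assoc]
      _ = _ := by rw [hU, Matrix.mul_one, Matrix.mul_assoc V]
  refine ⟨U * Vᵀ, ?_, ?_⟩
  · calc (U * Vᵀ)ᵀ * (U * Vᵀ) = V * (Uᵀ * U) * Vᵀ := by
          simp only [transpose_mul, transpose_transpose, Matrix.mul_assoc]
      _ = 1 := by rw [hU, Matrix.mul_one, hV']
  · rw [hsub, hgram, frobNorm_sq_mul_mul_transpose hU hV, frobNorm_sq_mul_mul_transpose hV hV,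
      frobNorm_sq_diagonal, frobNorm_sq_diagonal]
    refine Finset.sum_le_sum fun i _ => ?_
    have hfac : (d i * d i - 1) ^ 2 = (d i - 1) ^ 2 * (d i + 1) ^ 2 := by ring
    rw [hfac]
    exact le_mul_of_one_le_right (sq_nonneg _) (one_le_pow₀ (by linarith [hd i]))

theorem exists_isSemiOrthogonal_frobNorm_sub_le {r c : ℕ} (W : Matrix (Fin r) (Fin c) ℝ) :
    ∃ Q : Matrix (Fin r) (Fin c) ℝ, Q.IsSemiOrthogonal ∧
      (W - Q).frobNorm ^ 2 ≤ 4 * W.orthDefect := by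
  unfold IsSemiOrthogonal orthDefect
  split_ifs with h
  · obtain ⟨Q, hQ, hle⟩ := exists_transpose_mul_self_eq_one_frobNorm_sub_le h.le Wᵀ
    refine ⟨Qᵀ, by rwa [transpose_transpose], ?_⟩
    rw [transpose_transpose] at hle
    rw [← frobNorm_transpose, transpose_sub, transpose_transpose]
    linarith
  · obtain ⟨Q, hQ, hle⟩ := exists_transpose_mul_self_eq_one_frobNorm_sub_le (not_lt.1 h) W
    exact ⟨Q, hQ, by linarith⟩

end Matrix

/-- Blockwise polar projection bound: each block family `{W_b}` admits a
semi-orthogonal family `{Q_b}` with `Σ_b ‖W_b − Q_b‖_F² ≤ 4 Σ_b R(W_b)`;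
in particular every single matrix `W` admits a semi-orthogonal `Q` with
`‖W − Q‖_F² ≤ 4 R(W)`. -/
theorem exists_semiOrthogonal_polar_bound
    {B : Type*} [Fintype B] (rdim cdim : B → ℕ)
    (W : ∀ b : B, Matrix (Fin (rdim b)) (Fin (cdim b)) ℝ) :
    (∃ Q : ∀ b : B, Matrix (Fin (rdim b)) (Fin (cdim b)) ℝ,
        (∀ b, (Q b).IsSemiOrthogonal) ∧
        ∑ b, (W b - Q b).frobNorm ^ 2 ≤ 4 * ∑ b, (W b).orthDefect) ∧
      (∀ r c : ℕ, ∀ W' : Matrix (Fin r) (Fin c) ℝ,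
        ∃ Q' : Matrix (Fin r) (Fin c) ℝ, Q'.IsSemiOrthogonal ∧
          (W' - Q').frobNorm ^ 2 ≤ 4 * W'.orthDefect) := by
  choose Q hQ hle using fun b => (W b).exists_isSemiOrthogonal_frobNorm_sub_le
  refine ⟨⟨Q, hQ, ?_⟩, fun r c W' => W'.exists_isSemiOrthogonal_frobNorm_sub_le⟩
  rw [Finset.mul_sum]
  exact Finset.sum_le_sum fun b _ => hle b
end

section
/- Let L : ℝⁿ → ℝ be differentiable with gradient ∇L that is μ-Lipschitz for some μ > 0. Fix ω ∈ ℝⁿ, set g = ∇L(ω), and let u, Δ ∈ ℝⁿ and η > 0. Suppose ⟨g, Δ⟩ ≥ 0 (the conflict-free budget with τ = 0) and the stepsize satisfies η · μ · ‖Δ‖ · (2‖u‖ + ‖Δ‖) ≤ 2⟨g, Δ⟩. Then L(ω − ηu − ηΔ) ≤ L(ω − ηu); that is, the AdamO step does not increase the next-step loss relative to the Adam step. -/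
open scoped RealInnerProductSpace

/-- The descent lemma: a differentiable function with `μ`-Lipschitz gradient is `μ`-smooth. -/
theorem le_add_inner_gradient_add_of_lipschitz_gradient
    {E : Type*} [NormedAddCommGroup E] [InnerProductSpace ℝ E] [CompleteSpace E]
    {L : E → ℝ} (hL : Differentiable ℝ L) {μ : ℝ}
    (hLip : ∀ x y, ‖gradient L x - gradient L y‖ ≤ μ * ‖x - y‖) (x d : E) :
    L (x + d) ≤ L x + ⟪gradient L x, d⟫ + μ / 2 * ‖d‖ ^ 2 := by
  have hf (t : ℝ) : HasDerivAt (fun s : ℝ => L (x + s • d)) ⟪gradient L (x + t • d), d⟫ t := by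
    have hline : HasDerivAt (fun s : ℝ => x + s • d) d t := by
      simpa using ((hasDerivAt_id t).smul_const d).const_add x
    exact (hL (x + t • d)).hasGradientAt.hasFDerivAt.comp_hasDerivAt t hline
  have hB (t : ℝ) : HasDerivAt
      (fun s : ℝ => L x + s * ⟪gradient L x, d⟫ + s ^ 2 * (μ / 2 * ‖d‖ ^ 2))
      (⟪gradient L x, d⟫ + t * (μ * ‖d‖ ^ 2)) t := by
    refine ((((hasDerivAt_id t).mul_const ⟪gradient L x, d⟫).const_add (L x)).add
      ((hasDerivAt_pow 2 t).mul_const (μ / 2 * ‖d‖ ^ 2))).congr_deriv ?_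
    push_cast
    ring
  have hbound : ∀ t ∈ Set.Ico (0 : ℝ) 1,
      ⟪gradient L (x + t • d), d⟫ ≤ ⟪gradient L x, d⟫ + t * (μ * ‖d‖ ^ 2) := by
    intro t ht
    have hlip := hLip (x + t • d) x
    rw [add_sub_cancel_left, norm_smul, Real.norm_of_nonneg ht.1] at hlip
    have hcs := real_inner_le_norm (gradient L (x + t • d) - gradient L x) d
    rw [inner_sub_left] at hcs
    linarith [mul_le_mul_of_nonneg_right hlip (norm_nonneg d)]
  have hle := image_le_of_deriv_right_le_deriv_boundary
    (fun t _ => (hf t).continuousAt.continuousWithinAt)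
    (fun t _ => (hf t).hasDerivWithinAt) (by simp)
    (fun t _ => (hB t).continuousAt.continuousWithinAt)
    (fun t _ => (hB t).hasDerivWithinAt) hbound (Set.right_mem_Icc.2 zero_le_one)
  simpa using hle

/-- Conflict-free one-step non-inferiority: if `⟨g,Δ⟩ ≥ 0` and the stepsize
satisfies `ημ‖Δ‖(2‖u‖+‖Δ‖) ≤ 2⟨g,Δ⟩`, then the AdamO step does not increase the
next-step loss relative to the Adam step. -/
theorem adamo_one_step_noninferior
    {n : ℕ} (L : EuclideanSpace ℝ (Fin n) → ℝ) (hL : Differentiable ℝ L)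
    (μ : ℝ) (hμ : 0 < μ)
    (hLip : ∀ x y, ‖gradient L x - gradient L y‖ ≤ μ * ‖x - y‖)
    (ω u Δ : EuclideanSpace ℝ (Fin n)) (η : ℝ) (hη : 0 < η)
    (hbudget : 0 ≤ ⟪gradient L ω, Δ⟫)
    (hstep : η * μ * ‖Δ‖ * (2 * ‖u‖ + ‖Δ‖) ≤ 2 * ⟪gradient L ω, Δ⟫) :
    L (ω - η • u - η • Δ) ≤ L (ω - η • u) := by
  have hdescent := le_add_inner_gradient_add_of_lipschitz_gradient hL hLip (ω - η • u) (-(η • Δ))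
  rw [← sub_eq_add_neg, inner_neg_right, real_inner_smul_right, norm_neg, norm_smul,
    Real.norm_of_nonneg hη.le] at hdescent
  have hlip := hLip ω (ω - η • u)
  rw [sub_sub_cancel, norm_smul, Real.norm_of_nonneg hη.le] at hlip
  have hcs := real_inner_le_norm (gradient L ω - gradient L (ω - η • u)) Δ
  rw [inner_sub_left] at hcs
  have hinner : ⟪gradient L ω, Δ⟫ - ⟪gradient L (ω - η • u), Δ⟫ ≤ μ * (η * ‖u‖) * ‖Δ‖ :=
    hcs.trans (mul_le_mul_of_nonneg_right hlip (norm_nonneg Δ))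
  linarith [mul_le_mul_of_nonneg_left hinner hη.le, mul_le_mul_of_nonneg_left hstep hη.le]
end

section
/- Let L : ℝⁿ → ℝ be differentiable with gradient ∇L that is μ-Lipschitz for some μ > 0. Fix ω ∈ ℝⁿ, set g = ∇L(ω), and let u, Δ ∈ ℝⁿ, η > 0, τ ≥ 0, κ ≥ 0, and S ≥ 0. Suppose ⟨g, Δ⟩ ≥ −τ·S (the budgeted constraint) and ‖Δ‖ ≤ κ‖u‖ (the ratio clip). Then L(ω − ηu − ηΔ) − L(ω − ηu) ≤ η·τ·S + μ·η²·‖u‖²·(κ + κ²/2). -/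
open scoped RealInnerProductSpace

/-- Descent lemma: a differentiable function with `μ`-Lipschitz gradient is `μ`-smooth. -/
theorem le_add_inner_gradient_add_norm_sq {E : Type*} [NormedAddCommGroup E]
    [InnerProductSpace ℝ E] [CompleteSpace E] {f : E → ℝ} (hf : Differentiable ℝ f) {μ : ℝ}
    (hLip : ∀ x y, ‖gradient f x - gradient f y‖ ≤ μ * ‖x - y‖) (x d : E) :
    f (x + d) ≤ f x + ⟪gradient f x, d⟫ + μ / 2 * ‖d‖ ^ 2 := by
  let h : ℝ → ℝ := fun t => f (x + t • d) - t * ⟪gradient f x, d⟫ - μ / 2 * ‖d‖ ^ 2 * t ^ 2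
  have hderiv (t : ℝ) : HasDerivAt h
      (⟪gradient f (x + t • d), d⟫ - ⟪gradient f x, d⟫ - μ / 2 * ‖d‖ ^ 2 * (2 * t)) t := by
    have hline : HasDerivAt (fun s : ℝ => x + s • d) d t := by
      simpa using ((hasDerivAt_id t).smul_const d).const_add x
    have hcomp : HasDerivAt (fun s : ℝ => f (x + s • d)) ⟪gradient f (x + t • d), d⟫ t := by
      simpa [Function.comp_def] using
        (hf (x + t • d)).hasGradientAt.hasFDerivAt.comp_hasDerivAt t hline
    have hlin : HasDerivAt (fun s : ℝ => s * ⟪gradient f x, d⟫) ⟪gradient f x, d⟫ t := by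
      simpa using (hasDerivAt_id t).mul_const ⟪gradient f x, d⟫
    have hsq : HasDerivAt (fun s : ℝ => s ^ 2) (2 * t) t := by
      simpa using hasDerivAt_pow 2 t
    exact (hcomp.sub hlin).sub (hsq.const_mul (μ / 2 * ‖d‖ ^ 2))
  have hanti : AntitoneOn h (Set.Icc 0 1) := by
    refine antitoneOn_of_deriv_nonpos (convex_Icc 0 1)
      (fun t _ => (hderiv t).continuousAt.continuousWithinAt)
      (fun t _ => (hderiv t).differentiableAt.differentiableWithinAt) fun t ht => ?_
    rw [interior_Icc] at ht
    rw [(hderiv t).deriv, ← inner_sub_left]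
    have hgrad : ‖gradient f (x + t • d) - gradient f x‖ ≤ μ * (t * ‖d‖) := by
      simpa [norm_smul, abs_of_pos ht.1] using hLip (x + t • d) x
    nlinarith [real_inner_le_norm (gradient f (x + t • d) - gradient f x) d,
      mul_le_mul_of_nonneg_right hgrad (norm_nonneg d)]
  have hle : h 1 ≤ h 0 := hanti (by simp) (by simp) zero_le_one
  simp only [h, one_smul, zero_smul, add_zero] at hle
  linarith

/-- Budgeted one-step degradation bound: if `⟨g,Δ⟩ ≥ −τS` and `‖Δ‖ ≤ κ‖u‖`, then
`L(ω−ηu−ηΔ) − L(ω−ηu) ≤ ητS + μη²‖u‖²(κ + κ²/2)`. -/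
theorem adamo_one_step_degradation_bound
    {n : ℕ} (L : EuclideanSpace ℝ (Fin n) → ℝ) (hL : Differentiable ℝ L)
    (μ : ℝ) (hμ : 0 < μ)
    (hLip : ∀ x y, ‖gradient L x - gradient L y‖ ≤ μ * ‖x - y‖)
    (ω u Δ : EuclideanSpace ℝ (Fin n)) (η : ℝ) (hη : 0 < η)
    (τ : ℝ) (hτ : 0 ≤ τ) (κ : ℝ) (hκ : 0 ≤ κ) (S : ℝ) (hS : 0 ≤ S)
    (hbudget : ⟪gradient L ω, Δ⟫ ≥ -τ * S)
    (hclip : ‖Δ‖ ≤ κ * ‖u‖) :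
    L (ω - η • u - η • Δ) - L (ω - η • u)
      ≤ η * τ * S + μ * η ^ 2 * ‖u‖ ^ 2 * (κ + κ ^ 2 / 2) := by
  have hdescent := le_add_inner_gradient_add_norm_sq hL hLip (ω - η • u) (-(η • Δ))
  rw [← sub_eq_add_neg, inner_neg_right, real_inner_smul_right, norm_neg, norm_smul,
    Real.norm_of_nonneg hη.le] at hdescent
  have hgrad : ‖gradient L ω - gradient L (ω - η • u)‖ ≤ μ * (η * ‖u‖) := by
    simpa [norm_smul, abs_of_pos hη] using hLip ω (ω - η • u)
  have hinner : ⟪gradient L ω, Δ⟫ - ⟪gradient L (ω - η • u), Δ⟫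
      ≤ μ * (η * ‖u‖) * (κ * ‖u‖) := by
    rw [← inner_sub_left]
    exact (real_inner_le_norm _ _).trans (by gcongr)
  have hfirst : -(η * ⟪gradient L (ω - η • u), Δ⟫)
      ≤ η * (τ * S + μ * (η * ‖u‖) * (κ * ‖u‖)) := by
    rw [← mul_neg]
    gcongr
    linarith
  have hsecond : μ / 2 * (η * ‖Δ‖) ^ 2 ≤ μ / 2 * (η * (κ * ‖u‖)) ^ 2 := by gcongr
  linarith
end

section
/- Let L : ℝⁿ → ℝ be differentiable with gradient ∇L that is μ-Lipschitz for some μ > 0. Fix ω ∈ ℝⁿ, set g = ∇L(ω), and let u, Δ ∈ ℝⁿ, η > 0, τ ≥ 0, κ ≥ 0, S ≥ 0, and ε_t ≥ 0. Suppose ⟨g, Δ⟩ ≥ −τ·S, ‖Δ‖ ≤ κ‖u‖, ‖u‖ > 0, and κ + κ²/2 ≤ ε_t / (μ·η²·‖u‖²). Then L(ω − ηu − ηΔ) − L(ω − ηu) ≤ η·τ·S + ε_t. -/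
open scoped RealInnerProductSpace

/-- The descent lemma: a function whose gradient is `μ`-Lipschitz lies below its quadratic
upper model. -/
theorem le_add_inner_gradient_add_sq {E : Type*} [NormedAddCommGroup E] [InnerProductSpace ℝ E]
    [CompleteSpace E] {f : E → ℝ} (hf : Differentiable ℝ f) {μ : ℝ}
    (hLip : ∀ x y, ‖gradient f x - gradient f y‖ ≤ μ * ‖x - y‖) (x v : E) :
    f (x + v) ≤ f x + ⟪gradient f x, v⟫ + μ / 2 * ‖v‖ ^ 2 := by
  have hline (t : ℝ) :
      HasDerivAt (fun s : ℝ => f (x + s • v)) ⟪gradient f (x + t • v), v⟫ t := by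
    have hv : HasDerivAt (fun s : ℝ => x + s • v) v t := by
      simpa using ((hasDerivAt_id t).smul_const v).const_add x
    exact (hf (x + t • v)).hasGradientAt.hasFDerivAt.comp_hasDerivAt t hv
  have hmodel (t : ℝ) :
      HasDerivAt (fun s : ℝ => f x + s * ⟪gradient f x, v⟫ + μ / 2 * ‖v‖ ^ 2 * s ^ 2)
        (⟪gradient f x, v⟫ + μ * ‖v‖ ^ 2 * t) t := by
    refine ((((hasDerivAt_id t).mul_const ⟪gradient f x, v⟫).const_add (f x)).add
      ((hasDerivAt_pow 2 t).const_mul (μ / 2 * ‖v‖ ^ 2))).congr_deriv ?_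
    norm_num
    ring
  have h := image_le_of_deriv_right_le_deriv_boundary (a := 0) (b := 1)
    (fun t _ => (hline t).continuousAt.continuousWithinAt)
    (fun t _ => (hline t).hasDerivWithinAt) (by simp)
    (fun t _ => (hmodel t).continuousAt.continuousWithinAt)
    (fun t _ => (hmodel t).hasDerivWithinAt)
    (fun t ht => by
      have hgrad : ‖gradient f (x + t • v) - gradient f x‖ ≤ μ * (t * ‖v‖) := by
        simpa [norm_smul, abs_of_nonneg ht.1] using hLip (x + t • v) x
      have hinner := (real_inner_le_norm (gradient f (x + t • v) - gradient f x) v).trans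
        (mul_le_mul_of_nonneg_right hgrad (norm_nonneg v))
      rw [inner_sub_left] at hinner
      linarith)
    (Set.right_mem_Icc.mpr zero_le_one)
  simpa using h

/-- Budgeted one-step bound with curvature overhead budget: if additionally
`κ + κ²/2 ≤ ε_t/(μη²‖u‖²)`, then `L(ω−ηu−ηΔ) − L(ω−ηu) ≤ ητS + ε_t`. -/
theorem adamo_one_step_overhead_budget
    {n : ℕ} (L : EuclideanSpace ℝ (Fin n) → ℝ) (hL : Differentiable ℝ L)
    (μ : ℝ) (hμ : 0 < μ)
    (hLip : ∀ x y, ‖gradient L x - gradient L y‖ ≤ μ * ‖x - y‖)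
    (ω u Δ : EuclideanSpace ℝ (Fin n)) (η : ℝ) (hη : 0 < η)
    (τ : ℝ) (hτ : 0 ≤ τ) (κ : ℝ) (hκ : 0 ≤ κ) (S : ℝ) (hS : 0 ≤ S)
    (εt : ℝ) (hεt : 0 ≤ εt)
    (hbudget : ⟪gradient L ω, Δ⟫ ≥ -τ * S)
    (hclip : ‖Δ‖ ≤ κ * ‖u‖)
    (hu : 0 < ‖u‖)
    (hκbound : κ + κ ^ 2 / 2 ≤ εt / (μ * η ^ 2 * ‖u‖ ^ 2)) :
    L (ω - η • u - η • Δ) - L (ω - η • u) ≤ η * τ * S + εt := by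
  have hdescent := le_add_inner_gradient_add_sq hL hLip (ω - η • u) (-(η • Δ))
  rw [← sub_eq_add_neg, norm_neg, norm_smul, Real.norm_of_nonneg hη.le, inner_neg_right,
    real_inner_smul_right] at hdescent
  have hgrad : ‖gradient L ω - gradient L (ω - η • u)‖ ≤ μ * (η * ‖u‖) := by
    simpa [norm_smul, abs_of_pos hη] using hLip ω (ω - η • u)
  have hinner : ⟪gradient L ω, Δ⟫ - ⟪gradient L (ω - η • u), Δ⟫ ≤
      μ * (η * ‖u‖) * (κ * ‖u‖) := by
    rw [← inner_sub_left]
    exact (real_inner_le_norm _ _).trans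
      (mul_le_mul hgrad hclip (norm_nonneg Δ) (by positivity))
  have hcross : η * (-τ * S - ⟪gradient L (ω - η • u), Δ⟫) ≤
      η * (μ * (η * ‖u‖) * (κ * ‖u‖)) :=
    mul_le_mul_of_nonneg_left (by linarith) hη.le
  have hquad : μ / 2 * (η * ‖Δ‖) ^ 2 ≤ μ / 2 * (η * (κ * ‖u‖)) ^ 2 := by gcongr
  rw [le_div_iff₀ (by positivity)] at hκbound
  linarith
end
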